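/- Let 𝒯' ⊆ 𝒯 be staged trees sharing the same root, where 𝒯' is obtained from 𝒯 by removing some induced subtrees 𝒯(v). Then im φ_{𝒯'} ⊆ im φ_𝒯 as subalgebras of ℝ[Θ]/⟨θ−1⟩. -/

import Mathlib

noncomputable section
open scoped Classical
open MvPolynomial

/-- A staged tree: a finite rooted tree with edges directed away from the root,
each non-root vertex `c` carrying the label `label c` of the edge from `parent c` to `c`;
labels of outgoing edges of a vertex are pairwise distinct, and the outgoing label sets
of two vertices are either equal (same stage) or disjoint. -/
structure StagedTree (Θ : Type) [DecidableEq Θ] : Type 1 where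
  V : Type
  fintypeV : Fintype V
  decEqV : DecidableEq V
  root : V
  parent : V → V
  label : V → Θ
  parent_root : parent root = root
  reaches_root : ∀ v : V, ∃ n : ℕ, parent^[n] v = root
  label_inj : ∀ u v : V, u ≠ root → v ≠ root → parent u = parent v → label u = label v → u = v
  stage_disjoint : ∀ u v : V,
    (∀ θ : Θ, (∃ c, c ≠ root ∧ parent c = u ∧ label c = θ) ↔
        (∃ c, c ≠ root ∧ parent c = v ∧ label c = θ)) ∨
    (∀ θ : Θ, ¬((∃ c, c ≠ root ∧ parent c = u ∧ label c = θ) ∧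
        (∃ c, c ≠ root ∧ parent c = v ∧ label c = θ)))

namespace StagedTree

attribute [instance] StagedTree.fintypeV StagedTree.decEqV

variable {Θ : Type} [DecidableEq Θ] (T : StagedTree Θ)

/-- `c` is a child of `v`. -/
def IsChild (v c : T.V) : Prop := c ≠ T.root ∧ T.parent c = v

/-- `v` is a leaf (no children). -/
def IsLeaf (v : T.V) : Prop := ∀ c, ¬ T.IsChild v c

/-- `w` lies in the subtree rooted at `v` (i.e. `v` is an ancestor of `w` or `w` itself). -/
def Desc (v w : T.V) : Prop := ∃ n : ℕ, T.parent^[n] w = v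

/-- Distance of `v` from the root. -/
def depthOf (v : T.V) : ℕ := Nat.find (T.reaches_root v)

/-- The depth `d` of the tree: maximal number of edges on a root-to-leaf path. -/
def depth : ℕ := Finset.univ.sup T.depthOf

/-- The type of leaves of `T`. -/
def Leaf : Type := {v : T.V // T.IsLeaf v}

instance : Fintype T.Leaf := Subtype.fintype _

/-- Product of the labels along the root-to-`v` path, in `ℝ[Θ]`. -/
def pathProd (v : T.V) : MvPolynomial Θ ℝ :=
  ∏ i ∈ Finset.range (T.depthOf v), X (T.label (T.parent^[i] v))

/-- Homogenised root-to-`v` path monomial `z^(d - d(λ)) ∏ θ(e)` in `ℝ[Θ, z]`,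
where the variable `none` plays the role of `z`. -/
def hpm (v : T.V) : MvPolynomial (Option Θ) ℝ :=
  (X none) ^ (T.depth - T.depthOf v) *
    ∏ i ∈ Finset.range (T.depthOf v), X (some (T.label (T.parent^[i] v)))

/-- The ideal `⟨θ - z⟩` of homogenised local sum-to-one conditions. -/
def sumIdeal : Ideal (MvPolynomial (Option Θ) ℝ) :=
  Ideal.span {f | ∃ v : T.V, ¬ T.IsLeaf v ∧
    f = (∑ c ∈ Finset.univ.filter (fun c => T.IsChild v c), X (some (T.label c))) - X none}

/-- The homogenised parametrisation `φ_T : ℝ[p] → ℝ[Θ, z]/⟨θ - z⟩`. -/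
def phi : MvPolynomial T.Leaf ℝ →ₐ[ℝ] MvPolynomial (Option Θ) ℝ ⧸ T.sumIdeal :=
  aeval (fun l : T.Leaf => Ideal.Quotient.mk T.sumIdeal (T.hpm l.1))

/-- The ideal `⟨θ - 1⟩` of local sum-to-one conditions. -/
def oneIdeal : Ideal (MvPolynomial Θ ℝ) :=
  Ideal.span {f | ∃ v : T.V, ¬ T.IsLeaf v ∧
    f = (∑ c ∈ Finset.univ.filter (fun c => T.IsChild v c), X (T.label c)) - 1}

/-- The (non-homogenised) parametrisation `φ_T : ℝ[p] → ℝ[Θ]/⟨θ - 1⟩`. -/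
def phi1 : MvPolynomial T.Leaf ℝ →ₐ[ℝ] MvPolynomial Θ ℝ ⧸ T.oneIdeal :=
  aeval (fun l : T.Leaf => Ideal.Quotient.mk T.oneIdeal (T.pathProd l.1))

/-- The subtree polynomial `t(v)`: sum over all `v`-to-leaf paths of the products of
edge labels along the path. -/
def tpoly (v : T.V) : MvPolynomial Θ ℝ :=
  ∑ l ∈ Finset.univ.filter (fun w => T.IsLeaf w ∧ T.Desc v w),
    ∏ i ∈ Finset.range (T.depthOf l - T.depthOf v), X (T.label (T.parent^[i] l))

/-- Two non-leaf vertices are in the same stage when their outgoing label sets coincide. -/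
def SameStage (u v : T.V) : Prop :=
  ¬ T.IsLeaf u ∧ ¬ T.IsLeaf v ∧
    ∀ θ : Θ, (∃ c, T.IsChild u c ∧ T.label c = θ) ↔ (∃ c, T.IsChild v c ∧ T.label c = θ)

/-- `T` is balanced: `t(u_i)·t(v_j) = t(u_j)·t(v_i)` for all `u ∼ v` and all pairs of
children matched via the common labels. -/
def Balanced : Prop :=
  ∀ u v ui uj vi vj : T.V, T.SameStage u v →
    T.IsChild u ui → T.IsChild u uj → T.IsChild v vi → T.IsChild v vj →
    T.label ui = T.label vi → T.label uj = T.label vj →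
    T.tpoly ui * T.tpoly vj = T.tpoly uj * T.tpoly vi

/-- `p_{[v]}`: sum of the variables `p_r` over root-to-leaf paths through `v`. -/
def pSum (v : T.V) : MvPolynomial T.Leaf ℝ :=
  ∑ l ∈ Finset.univ.filter (fun l : T.Leaf => T.Desc v l.1), X l

/-- `T` has toric structure: there are linearly independent linear forms in which
`ker φ_T` is generated by binomials. -/
def Toric : Prop :=
  ∃ L : T.Leaf → MvPolynomial T.Leaf ℝ,
    (∀ i, (L i).IsHomogeneous 1) ∧ LinearIndependent ℝ L ∧
    ∃ B : Set (MvPolynomial T.Leaf ℝ),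
      (∀ f ∈ B, ∃ a b : T.Leaf → ℕ, f = (∏ i, L i ^ a i) - (∏ i, L i ^ b i)) ∧
      RingHom.ker T.phi.toRingHom = Ideal.span B

end StagedTree

namespace StagedTree

variable {Θ : Type} [DecidableEq Θ] (T : StagedTree Θ)

/-- `v` is a leaf of the subtree determined by the parent-closed set `S`. -/
def SubLeaf (S : Set T.V) (v : T.V) : Prop :=
  v ∈ S ∧ ∀ c, T.IsChild v c → c ∉ S

/-- The parametrisation of the subtree `𝒯'` determined by the parent-closed set `S`,
with target the same quotient ring `ℝ[Θ]/⟨θ−1⟩` as for `𝒯`. -/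
def phiSub (S : Set T.V) :
    MvPolynomial {v : T.V // T.SubLeaf S v} ℝ →ₐ[ℝ] MvPolynomial Θ ℝ ⧸ T.oneIdeal :=
  MvPolynomial.aeval (fun w => Ideal.Quotient.mk T.oneIdeal (T.pathProd w.1))

variable {T} in
theorem IsChild.depthOf_eq {v c : T.V} (h : T.IsChild v c) :
    T.depthOf c = T.depthOf v + 1 := by
  obtain ⟨hc, rfl⟩ := h
  have h₁ : ∃ n, T.parent^[n + 1] c = T.root := T.reaches_root (T.parent c)
  exact Nat.find_comp_succ (T.reaches_root c) h₁ hc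

variable {T} in
theorem IsChild.pathProd_eq {v c : T.V} (h : T.IsChild v c) :
    T.pathProd c = T.pathProd v * X (T.label c) := by
  rw [pathProd, h.depthOf_eq, Finset.prod_range_succ']
  simp only [Function.iterate_succ_apply, Function.iterate_zero, id, h.2, pathProd]

theorem depthOf_le_depth (v : T.V) : T.depthOf v ≤ T.depth :=
  Finset.le_sup (f := T.depthOf) (Finset.mem_univ v)

/-- Modulo the sum-to-one conditions, the path monomial of an inner vertex is the sum of the
path monomials of its children. -/
theorem mk_pathProd_eq_sum {v : T.V} (hv : ¬ T.IsLeaf v) :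
    Ideal.Quotient.mk T.oneIdeal (T.pathProd v) =
      ∑ c ∈ Finset.univ.filter (fun c => T.IsChild v c),
        Ideal.Quotient.mk T.oneIdeal (T.pathProd c) := by
  rw [← map_sum, eq_comm, Ideal.Quotient.eq,
    Finset.sum_congr rfl fun c hc => (Finset.mem_filter.1 hc).2.pathProd_eq, ← Finset.mul_sum]
  have hmem : (∑ c ∈ Finset.univ.filter (fun c => T.IsChild v c), X (T.label c)) - 1 ∈
      T.oneIdeal := Ideal.subset_span ⟨v, hv, rfl⟩
  simpa only [mul_sub, mul_one] using T.oneIdeal.mul_mem_left (T.pathProd v) hmem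

theorem mk_pathProd_mem_range_phi1 (v : T.V) :
    Ideal.Quotient.mk T.oneIdeal (T.pathProd v) ∈ T.phi1.range := by
  induction hn : T.depth - T.depthOf v using Nat.strong_induction_on generalizing v with
  | _ n ih =>
    by_cases hv : T.IsLeaf v
    · exact ⟨X (⟨v, hv⟩ : T.Leaf), aeval_X _ _⟩
    · rw [T.mk_pathProd_eq_sum hv]
      refine sum_mem fun c hc => ih _ ?_ c rfl
      have hd := (Finset.mem_filter.1 hc).2.depthOf_eq
      have hle := T.depthOf_le_depth c
      omega

/-- If `𝒯' ⊆ 𝒯` share the same root (`𝒯'` is obtained from `𝒯` by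
removing induced subtrees, i.e. its vertex set is a parent-closed subset `S` containing
the root), then `im φ_{𝒯'} ⊆ im φ_𝒯` inside `ℝ[Θ]/⟨θ−1⟩`. -/
theorem range_phiSub_le_range_phi1 (S : Set T.V)
    (hroot : T.root ∈ S) (hpar : ∀ w ∈ S, T.parent w ∈ S) :
    (T.phiSub S).range ≤ T.phi1.range := by
  rw [phiSub, ← Algebra.adjoin_range_eq_range_aeval, Algebra.adjoin_le_iff]
  rintro _ ⟨w, rfl⟩
  exact T.mk_pathProd_mem_range_phi1 w.1

end StagedTree
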